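/- There is no rational solution (q1,p1,q2,p2) of A5^(2)(α0,α1,α2,α3) such that all four of |q1(t)|, |p1(t)|, |q2(t)|, |p2(t)| tend to ∞ as |t| → ∞ (i.e., such that q1, p1, q2, p2 all have a pole at infinity). -/

import Mathlib

open Filter Topology Polynomial

/-- Evaluation of a rational function with complex coefficients at a point,
using its reduced numerator and denominator. -/
noncomputable def evR (f : RatFunc ℂ) (t : ℂ) : ℂ := f.num.eval t / f.denom.eval t

/-- A rational function has no pole at `c` if its reduced denominator does not vanish at `c`. -/
def NoPoleAt (f : RatFunc ℂ) (c : ℂ) : Prop := f.denom.eval c ≠ 0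

/-- `(q1, p1, q2, p2)` is a rational solution of the Sasano system
`A5^(2)(α0, α1, α2, α3)` (the parameter `α2` does not occur in the equations):
the four differential equations hold at every point `t ∈ ℂ` which is not a pole
of any of `q1, p1, q2, p2`. -/
def IsSasanoSol (a0 a1 a3 : ℂ) (q1 p1 q2 p2 : RatFunc ℂ) : Prop :=
  ∀ t : ℂ, NoPoleAt q1 t → NoPoleAt p1 t → NoPoleAt q2 t → NoPoleAt p2 t →
    (t * deriv (evR q1) t =
      2 * (evR q1 t) ^ 2 * evR p1 t - (evR q1 t) ^ 2 + (a0 + a1 + a3) * evR q1 t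
        - t + 4 * t * evR p2 t + 2 * evR q1 t * evR q2 t * evR p2 t) ∧
    (t * deriv (evR p1) t =
      -2 * evR q1 t * (evR p1 t) ^ 2 + 2 * evR q1 t * evR p1 t
        - (a0 + a1 + a3) * evR p1 t + a0 - 2 * evR p1 t * evR q2 t * evR p2 t) ∧
    (t * deriv (evR q2) t =
      2 * (evR q2 t) ^ 2 * evR p2 t - (evR q2 t) ^ 2 + (a0 + a1 + a3) * evR q2 t
        - t + 4 * t * evR p1 t + 2 * evR q1 t * evR p1 t * evR q2 t) ∧
    (t * deriv (evR p2) t =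
      -2 * evR q2 t * (evR p2 t) ^ 2 + 2 * evR q2 t * evR p2 t
        - (a0 + a1 + a3) * evR p2 t + a1 - 2 * evR q1 t * evR p1 t * evR p2 t)


lemma eventually_eval_ne {P : ℂ[X]} (hP : P ≠ 0) : ∀ᶠ t in cocompact ℂ, P.eval t ≠ 0 := by
  have h : (P.roots.toFinset : Set ℂ).Finite := Finset.finite_toSet _
  filter_upwards [h.isCompact.compl_mem_cocompact] with t ht h0
  apply ht
  simp [hP, h0]

lemma tendsto_inv_sub (r : ℂ) : Tendsto (fun t : ℂ => (t - r)⁻¹) (cocompact ℂ) (𝓝 0) := by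
  have h : Tendsto (fun t : ℂ => t - r) (cocompact ℂ) (cocompact ℂ) :=
    (Homeomorph.subRight r).isClosedEmbedding.tendsto_cocompact
  exact tendsto_inv₀_cobounded.comp (by rwa [← Metric.cobounded_eq_cocompact] at h ⊢)

lemma tendsto_log_poly {P : ℂ[X]} (hP : P ≠ 0) :
    ∃ c, Tendsto (fun t => t * (P.derivative.eval t / P.eval t)) (cocompact ℂ) (𝓝 c) := by
  have h1 : ∀ r : ℂ, Tendsto (fun t : ℂ => t * (1 / (t - r))) (cocompact ℂ) (𝓝 1) := by
    intro r
    have h := ((tendsto_inv_sub r).const_mul r).const_add 1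
    simp only [mul_zero, add_zero] at h
    refine h.congr' ?_
    have : ∀ᶠ t in cocompact ℂ, t ≠ r := by
      filter_upwards [(isCompact_singleton (x := r)).compl_mem_cocompact] with t ht
      simpa using ht
    filter_upwards [this] with t ht
    have : t - r ≠ 0 := sub_ne_zero.2 ht
    field_simp
    ring
  refine ⟨(P.roots.map (fun _ => (1 : ℂ))).sum, ?_⟩
  have := tendsto_multiset_sum (f := fun (r t : ℂ) => t * (1 / (t - r)))
    (x := cocompact ℂ) (a := fun _ => (1 : ℂ)) P.roots (fun r _ => h1 r)
  refine this.congr' ?_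
  filter_upwards [eventually_eval_ne hP] with t ht
  rw [(IsAlgClosed.splits P).eval_derivative_div_eval_of_ne_zero ht,
    Multiset.sum_map_mul_left]

lemma tendsto_log_evR {f : RatFunc ℂ} (hf : f ≠ 0) :
    ∃ c, Tendsto (fun t => t * deriv (evR f) t / evR f t) (cocompact ℂ) (𝓝 c) := by
  obtain ⟨c, hc⟩ := tendsto_log_poly (RatFunc.num_ne_zero hf)
  obtain ⟨d, hd⟩ := tendsto_log_poly (RatFunc.denom_ne_zero f)
  refine ⟨c - d, (hc.sub hd).congr' ?_⟩
  filter_upwards [eventually_eval_ne (RatFunc.num_ne_zero hf),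
    eventually_eval_ne (RatFunc.denom_ne_zero f)] with t h1 h2
  have := ((f.num.hasDerivAt t).div (f.denom.hasDerivAt t) h2).deriv
  have h3 : deriv (evR f) t = _ := this
  rw [h3, evR]
  field_simp

lemma sasano_half {l : Filter ℂ} {q p Q L M : ℂ → ℂ} {c d s a : ℂ} {w : ℂ → ℂ}
    (hL : Tendsto L l (𝓝 c)) (hM : Tendsto M l (𝓝 d))
    (hq : Tendsto (fun t => (q t)⁻¹) l (𝓝 0)) (hp : Tendsto (fun t => (p t)⁻¹) l (𝓝 0))
    (hQ : Tendsto (fun t => (Q t)⁻¹) l (𝓝 0))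
    (q0 : ∀ᶠ t in l, q t ≠ 0) (p0 : ∀ᶠ t in l, p t ≠ 0) (Q0 : ∀ᶠ t in l, Q t ≠ 0)
    (e1 : ∀ᶠ t in l, L t * q t = 2 * w t * q t - q t ^ 2 + s * q t - t + 4 * t * Q t)
    (e2 : ∀ᶠ t in l, M t * p t = -2 * w t * p t + 2 * q t * p t - s * p t + a) :
    Tendsto (fun t => w t * (q t)⁻¹) l (𝓝 1) ∧
    Tendsto (fun t => t * Q t * ((q t)⁻¹) ^ 2) l (𝓝 (-1/4)) := by
  constructor
  · have h := ((((hM.neg.sub_const s).add (hp.const_mul a)).mul hq).const_add 2).div_const 2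
    norm_num at h
    refine h.congr' ?_
    filter_upwards [q0, p0, e2] with t h1 h2 h3
    field_simp
    linear_combination -h3
  · have h := (((hL.add hM).sub (hp.const_mul a)).mul hq).sub_const 1
    have h' := h.div (hQ.const_sub 4) (by norm_num)
    norm_num at h'
    have h4 : ∀ᶠ t in l, 4 - (Q t)⁻¹ ≠ 0 :=
      (hQ.const_sub 4).eventually_ne (by norm_num)
    norm_num
    refine h'.congr' ?_
    filter_upwards [q0, p0, Q0, e1, e2, h4] with t h1 h2 h3 e1 e2 h4
    simp only [Pi.div_apply]
    rw [div_eq_iff h4]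
    field_simp
    linear_combination p t * e1 + q t * e2

theorem sasano_no_solution_all_pole_at_infinity (a0 a1 a2 a3 : ℂ)
    (hpar : a0 + a1 + 2 * a2 + a3 = 1 / 2) :
    ¬ ∃ q1 p1 q2 p2 : RatFunc ℂ, IsSasanoSol a0 a1 a3 q1 p1 q2 p2 ∧
      Tendsto (fun t => ‖evR q1 t‖) (cocompact ℂ) atTop ∧
      Tendsto (fun t => ‖evR p1 t‖) (cocompact ℂ) atTop ∧
      Tendsto (fun t => ‖evR q2 t‖) (cocompact ℂ) atTop ∧
      Tendsto (fun t => ‖evR p2 t‖) (cocompact ℂ) atTop := by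
  rintro ⟨q1, p1, q2, p2, hs, hq1, hp1, hq2, hp2⟩
  have inv : ∀ f : RatFunc ℂ, Tendsto (fun t => ‖evR f t‖) (cocompact ℂ) atTop →
      Tendsto (fun t => (evR f t)⁻¹) (cocompact ℂ) (𝓝 0) := fun f hf =>
    tendsto_inv₀_cobounded.comp (tendsto_norm_atTop_iff_cobounded.1 hf)
  have ne : ∀ f : RatFunc ℂ, Tendsto (fun t => ‖evR f t‖) (cocompact ℂ) atTop →
      ∀ᶠ t in cocompact ℂ, evR f t ≠ 0 := by
    intro f hf
    filter_upwards [hf.eventually_gt_atTop 0] with t ht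
    exact norm_pos_iff.1 ht
  have log : ∀ f : RatFunc ℂ, Tendsto (fun t => ‖evR f t‖) (cocompact ℂ) atTop →
      ∃ c, Tendsto (fun t => t * deriv (evR f) t / evR f t) (cocompact ℂ) (𝓝 c) := by
    intro f hf
    apply tendsto_log_evR
    rintro rfl
    obtain ⟨t, ht⟩ := (ne _ hf).exists
    simp [evR] at ht
  have hev : ∀ f : RatFunc ℂ, ∀ᶠ t in cocompact ℂ, NoPoleAt f t := fun f =>
    eventually_eval_ne (RatFunc.denom_ne_zero f)
  have hsol := ((hev q1).and ((hev p1).and ((hev q2).and (hev p2)))).mono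
    (fun t h => hs t h.1 h.2.1 h.2.2.1 h.2.2.2)
  obtain ⟨c1, l1⟩ := log q1 hq1
  obtain ⟨d1, m1⟩ := log p1 hp1
  obtain ⟨c2, l2⟩ := log q2 hq2
  obtain ⟨d2, m2⟩ := log p2 hp2
  have nq1 := ne q1 hq1
  have np1 := ne p1 hp1
  have nq2 := ne q2 hq2
  have np2 := ne p2 hp2
  obtain ⟨A, X⟩ := sasano_half (s := a0 + a1 + a3) (a := a0)
    (w := fun t => evR q1 t * evR p1 t + evR q2 t * evR p2 t) (Q := evR p2)
    l1 m1 (inv _ hq1) (inv _ hp1) (inv _ hp2) nq1 np1 np2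
    (by filter_upwards [nq1, hsol] with t h h'
        rw [div_mul_cancel₀ _ h]
        linear_combination h'.1)
    (by filter_upwards [np1, hsol] with t h h'
        rw [div_mul_cancel₀ _ h]
        linear_combination h'.2.1)
  obtain ⟨B, Y⟩ := sasano_half (s := a0 + a1 + a3) (a := a1)
    (w := fun t => evR q1 t * evR p1 t + evR q2 t * evR p2 t) (Q := evR p1)
    l2 m2 (inv _ hq2) (inv _ hp2) (inv _ hp1) nq2 np2 np1
    (by filter_upwards [nq2, hsol] with t h h'
        rw [div_mul_cancel₀ _ h]
        linear_combination h'.2.2.1)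
    (by filter_upwards [np2, hsol] with t h h'
        rw [div_mul_cancel₀ _ h]
        linear_combination h'.2.2.2)
  have hS : Tendsto (fun t => evR q2 t / evR q1 t) (cocompact ℂ) (𝓝 1) := by
    have h := A.div B one_ne_zero
    rw [div_one] at h
    refine h.congr' ?_
    filter_upwards [nq1, nq2, A.eventually_ne one_ne_zero] with t h1 h2 h3
    have := left_ne_zero_of_mul h3
    simp only [Pi.div_apply]
    field_simp
  have hR : Tendsto (fun t => evR p1 t / evR p2 t) (cocompact ℂ) (𝓝 1) := by
    have h := (Y.div X (by norm_num)).mul (hS.pow 2)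
    norm_num at h
    refine h.congr' ?_
    have t0 : ∀ᶠ t in cocompact ℂ, t ≠ (0 : ℂ) := by
      filter_upwards [(isCompact_singleton (x := (0 : ℂ))).compl_mem_cocompact] with t ht
      simpa using ht
    filter_upwards [nq1, nq2, np2, t0] with t h1 h2 h3 h4
    field_simp
  have hfin := A.mul (inv _ hp2)
  rw [mul_zero] at hfin
  have hfin2 := hR.add hS
  have : Tendsto (fun t => evR p1 t / evR p2 t + evR q2 t / evR q1 t) (cocompact ℂ) (𝓝 0) := by
    refine hfin.congr' ?_
    filter_upwards [nq1, np2] with t h1 h2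
    field_simp
  have := tendsto_nhds_unique hfin2 this
  norm_num at this
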